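/- For every t > 0, every r ∈ [0,1], and every φ ∈ [−π/2, π/2], one has Im(2ir√t·exp(−iφ − e^{2iφ}/2)) ≤ 2√(t/e), with equality if and only if r = 1 and φ = 0. -/

import Mathlib

/-- The normalised height function. -/
noncomputable def hgt (x : ℝ) : ℝ :=
  Real.exp (Real.sin x ^ 2) * Real.cos (x + Real.sin x * Real.cos x)

lemma hgt_deriv (x : ℝ) : HasDerivAt hgt
    (-(2 * Real.cos x * Real.exp (Real.sin x ^ 2) * Real.sin (Real.sin x * Real.cos x))) x := by
  have h1 := ((Real.hasDerivAt_sin x).pow 2).exp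
  have h2 := ((hasDerivAt_id x).add ((Real.hasDerivAt_sin x).mul (Real.hasDerivAt_cos x))).cos
  have h := h1.mul h2
  have e : Real.sin (Real.sin x * Real.cos x)
      = Real.sin (x + Real.sin x * Real.cos x) * Real.cos x
        - Real.cos (x + Real.sin x * Real.cos x) * Real.sin x := by
    rw [← Real.sin_sub]; congr 1; ring
  have e2 : Real.sin x ^ 2 = 1 - Real.cos x ^ 2 := Real.sin_sq x
  refine h.congr_deriv ?_
  rw [e]
  simp
  generalize Real.sin (x + Real.sin x * Real.cos x) = S
  generalize Real.cos (x + Real.sin x * Real.cos x) = C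
  generalize Real.exp (Real.sin x ^ 2) = E
  linear_combination (E * S) * e2

lemma hgt_anti : StrictAntiOn hgt (Set.Icc 0 (Real.pi / 2)) := by
  apply strictAntiOn_of_deriv_neg (convex_Icc _ _)
  · exact fun x _ => (hgt_deriv x).continuousAt.continuousWithinAt
  · intro x hx
    rw [interior_Icc] at hx
    rw [(hgt_deriv x).deriv]
    have hc : 0 < Real.cos x := Real.cos_pos_of_mem_Ioo ⟨by linarith [hx.1, Real.pi_pos], hx.2⟩
    have hs : 0 < Real.sin x := Real.sin_pos_of_pos_of_lt_pi hx.1 (by linarith [hx.2, Real.pi_pos])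
    have hsc : 0 < Real.sin (Real.sin x * Real.cos x) := by
      apply Real.sin_pos_of_pos_of_lt_pi (by positivity)
      nlinarith [Real.sin_le_one x, Real.cos_le_one x, Real.pi_gt_three]
    have : 0 < 2 * Real.cos x * Real.exp (Real.sin x ^ 2) * Real.sin (Real.sin x * Real.cos x) := by
      positivity
    linarith

lemma hgt_zero : hgt 0 = 1 := by simp [hgt]

lemma hgt_neg (x : ℝ) : hgt (-x) = hgt x := by
  unfold hgt
  rw [Real.sin_neg, Real.cos_neg, neg_sq, ← Real.cos_neg (x + _)]
  congr 2; ring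

lemma hgt_lt (x : ℝ) (hx : x ∈ Set.Icc (-(Real.pi / 2)) (Real.pi / 2)) (h0 : x ≠ 0) :
    hgt x < 1 := by
  have hp := Real.pi_pos
  rw [← hgt_zero]
  rcases lt_or_gt_of_ne h0 with h | h
  · rw [← hgt_neg x]
    exact hgt_anti ⟨le_rfl, by linarith⟩ ⟨by linarith, by linarith [hx.1]⟩ (by linarith)
  · exact hgt_anti ⟨le_rfl, by linarith⟩ ⟨h.le, hx.2⟩ h

lemma height_eq (t r φ : ℝ) (ht : 0 < t) :
    (2 * Complex.I * (r : ℂ) * (Real.sqrt t : ℂ) *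
        Complex.exp (-(Complex.I * (φ : ℂ))
          - Complex.exp (2 * Complex.I * (φ : ℂ)) / 2)).im
      = 2 * Real.sqrt (t / Real.exp 1) * (r * hgt φ) := by
  have h1 : Complex.exp (2 * Complex.I * (φ : ℂ))
      = (Real.cos (2 * φ) : ℂ) + (Real.sin (2 * φ) : ℂ) * Complex.I := by
    rw [show 2 * Complex.I * (φ : ℂ) = ((2 * φ : ℝ) : ℂ) * Complex.I by push_cast; ring,
      Complex.exp_mul_I]
    push_cast; rfl
  have h2 : -(Complex.I * (φ : ℂ)) - Complex.exp (2 * Complex.I * (φ : ℂ)) / 2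
      = ((-1 / 2 + Real.sin φ ^ 2 : ℝ) : ℂ)
        + ((-(φ + Real.sin φ * Real.cos φ) : ℝ) : ℂ) * Complex.I := by
    rw [h1, Real.sin_two_mul, Real.cos_two_mul, Real.cos_sq']
    push_cast; ring
  have h3 : (2 * Complex.I * (r : ℂ) * (Real.sqrt t : ℂ) *
        Complex.exp (-(Complex.I * (φ : ℂ))
          - Complex.exp (2 * Complex.I * (φ : ℂ)) / 2))
      = ((2 * r * Real.sqrt t : ℝ) : ℂ) * (Complex.I * Complex.exp (-(Complex.I * (φ : ℂ))
          - Complex.exp (2 * Complex.I * (φ : ℂ)) / 2)) := by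
    push_cast; ring
  rw [h3, Complex.im_ofReal_mul, Complex.I_mul_im, h2, Complex.exp_re]
  have hre (a b : ℝ) : ((a : ℂ) + (b : ℂ) * Complex.I).re = a := by simp
  have him (a b : ℝ) : ((a : ℂ) + (b : ℂ) * Complex.I).im = b := by simp
  rw [hre, him, Real.cos_neg, Real.exp_add, Real.sqrt_div ht.le, ← Real.exp_half,
    show (-1 / 2 : ℝ) = -(1 / 2) by norm_num, Real.exp_neg]
  unfold hgt
  ring

/-- Maximal height of the SLE hull in the hydrodynamic limit started from a
single source: `Im(2ir√t exp(-iφ - e^{2iφ}/2)) ≤ 2√(t/e)`, with equality iff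
`r = 1` and `φ = 0`. -/
theorem stmt_8 (t : ℝ) (ht : 0 < t) (r : ℝ) (hr : r ∈ Set.Icc (0:ℝ) 1)
    (φ : ℝ) (hφ : φ ∈ Set.Icc (-(Real.pi / 2)) (Real.pi / 2)) :
    (2 * Complex.I * (r : ℂ) * (Real.sqrt t : ℂ) *
        Complex.exp (-(Complex.I * (φ : ℂ))
          - Complex.exp (2 * Complex.I * (φ : ℂ)) / 2)).im
      ≤ 2 * Real.sqrt (t / Real.exp 1) ∧
    ((2 * Complex.I * (r : ℂ) * (Real.sqrt t : ℂ) *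
        Complex.exp (-(Complex.I * (φ : ℂ))
          - Complex.exp (2 * Complex.I * (φ : ℂ)) / 2)).im
      = 2 * Real.sqrt (t / Real.exp 1) ↔ r = 1 ∧ φ = 0) := by
  have hs : 0 < 2 * Real.sqrt (t / Real.exp 1) := by positivity
  rw [height_eq t r φ ht]
  have hle : r * hgt φ ≤ 1 ∧ (r * hgt φ = 1 ↔ r = 1 ∧ φ = 0) := by
    by_cases h0 : φ = 0
    · subst h0
      simp [hgt_zero, hr.2]
    · have hl := hgt_lt φ hφ h0
      have : r * hgt φ < 1 := by
        rcases le_or_gt (hgt φ) 0 with h | h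
        · nlinarith [hr.1]
        · nlinarith [hr.2]
      exact ⟨this.le, fun h => absurd h this.ne, fun h => absurd h.2 h0⟩
  refine ⟨mul_le_of_le_one_right hs.le hle.1, ?_⟩
  rw [← hle.2]
  exact mul_eq_left₀ hs.ne'
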